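/- arXiv:2403.19017 — 2 statements merged into one kernel-verified Lean document; each statement's English description precedes it below -/
import Mathlib

section
/- For distinct positive reals a₁,…,a_N, the matrix P'(N) with entries P'_{ij} = a_j π_j(N)/(a_i + a_j), where π_j(N) = 2∏_{m≠j, m≤N} (1+a_m/a_j)/(1−a_m/a_j), is an involution: P'(N)² = I. -/
open Finset in
/-- A Lagrange interpolation identity: the polynomial `∏ m ∈ s.erase k, (X + a m)`, interpolated at
the nodes `a j`, evaluated at `x`. -/
theorem prod_erase_add_eq_sum {F ι : Type*} [Field F] [DecidableEq ι] {s : Finset ι} {a : ι → F}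
    (ha : Set.InjOn a s) {k : ι} (hk : k ∈ s) {x : F} (hx : ∀ i ∈ s, x ≠ a i) :
    ∏ m ∈ s.erase k, (x + a m) = (∏ m ∈ s, (x - a m)) *
      ∑ j ∈ s, (∏ m ∈ s.erase j, (a j - a m)⁻¹) * (x - a j)⁻¹ *
        ∏ m ∈ s.erase k, (a j + a m) := by
  have hdeg : (Lagrange.nodal (s.erase k) (fun m => -a m)).degree < #s := by
    rw [Lagrange.degree_nodal]
    exact_mod_cast card_erase_lt_of_mem hk
  have h := congrArg (Polynomial.eval x) (Lagrange.eq_interpolate ha hdeg)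
  rw [Lagrange.eval_interpolate_not_at_node _ hx] at h
  simpa only [Lagrange.eval_nodal, sub_neg_eq_add, Lagrange.nodalWeight] using h

theorem stmt_14 (N : ℕ) (a : Fin N → ℝ)
    (hapos : ∀ n, 0 < a n) (hainj : Function.Injective a)
    (π : Fin N → ℝ)
    (hπ : ∀ n, π n = 2 * ∏ m ∈ Finset.univ.erase n, (1 + a m / a n) / (1 - a m / a n)) :
    (Matrix.of fun i j : Fin N => a j * π j / (a i + a j)) *
      (Matrix.of fun i j : Fin N => a j * π j / (a i + a j)) = 1 := by
  have hadd : ∀ i j, a i + a j ≠ 0 := fun i j => (add_pos (hapos i) (hapos j)).ne'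
  have hsub : ∀ j, ∀ m ∈ Finset.univ.erase j, a j - a m ≠ 0 := fun j m hm =>
    sub_ne_zero.2 fun h => Finset.ne_of_mem_erase hm (hainj h).symm
  have hπ' : ∀ j, π j = 2 * ∏ m ∈ Finset.univ.erase j, (a j + a m) / (a j - a m) := by
    intro j
    rw [hπ]
    congr 1
    refine Finset.prod_congr rfl fun m _ => ?_
    have hj := (hapos j).ne'
    rw [one_add_div hj, one_sub_div hj, div_div_div_cancel_right₀ hj]
  have hweight : ∀ j k, a j * π j / (a j + a k) =
      (∏ m ∈ Finset.univ.erase j, (a j - a m)⁻¹) * ∏ m ∈ Finset.univ.erase k, (a j + a m) := by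
    intro j k
    have h1 := Finset.mul_prod_erase Finset.univ (fun m => a j + a m) (Finset.mem_univ j)
    have h2 := Finset.mul_prod_erase Finset.univ (fun m => a j + a m) (Finset.mem_univ k)
    rw [div_eq_iff (hadd j k), hπ' j]
    simp only [div_eq_mul_inv, Finset.prod_mul_distrib]
    linear_combination (∏ m ∈ Finset.univ.erase j, (a j - a m)⁻¹) * (h1 - h2)
  ext i k
  have hx : ∀ j ∈ Finset.univ, -a i ≠ a j := fun j _ h => hadd i j (by linarith)
  have key := prod_erase_add_eq_sum hainj.injOn (Finset.mem_univ k) hx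
  have hsum : ∑ j, (∏ m ∈ Finset.univ.erase j, (a j - a m)⁻¹) * (-a i - a j)⁻¹ *
      ∏ m ∈ Finset.univ.erase k, (a j + a m) =
      -∑ j, a j * π j / (a i + a j) * (a j + a k)⁻¹ := by
    rw [← Finset.sum_neg_distrib]
    refine Finset.sum_congr rfl fun j _ => ?_
    have hw := hweight j k
    rw [show -a i - a j = -(a i + a j) by ring, inv_neg]
    rw [div_eq_mul_inv] at hw ⊢
    linear_combination (a i + a j)⁻¹ * hw
  rw [hsum] at key
  have hentry : ((Matrix.of fun i j : Fin N => a j * π j / (a i + a j)) *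
      (Matrix.of fun i j : Fin N => a j * π j / (a i + a j))) i k =
      a k * π k * ∑ j, a j * π j / (a i + a j) * (a j + a k)⁻¹ := by
    rw [Matrix.mul_apply, Finset.mul_sum]
    refine Finset.sum_congr rfl fun j _ => ?_
    simp only [Matrix.of_apply]
    ring
  rw [hentry]
  have hne : ∏ m, (-a i - a m) ≠ 0 :=
    Finset.prod_ne_zero_iff.2 fun m hm => sub_ne_zero.2 (hx m hm)
  rcases eq_or_ne i k with rfl | hik
  · rw [Matrix.one_apply_eq]
    rw [← Finset.mul_prod_erase _ _ (Finset.mem_univ i)] at key hne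
    refine mul_left_cancel₀ hne ?_
    have hprod : π i * ∏ m ∈ Finset.univ.erase i, (-a i + a m) =
        2 * ∏ m ∈ Finset.univ.erase i, (-a i - a m) := by
      rw [hπ' i, mul_assoc, ← Finset.prod_mul_distrib]
      congr 1
      refine Finset.prod_congr rfl fun m hm => ?_
      have := hsub i m hm
      field_simp
      ring
    linear_combination (-a i) * hprod + a i * π i * key
  · rw [Matrix.one_apply_ne hik]
    have h0 : ∏ m ∈ Finset.univ.erase k, (-a i + a m) = 0 :=
      Finset.prod_eq_zero (Finset.mem_erase.2 ⟨hik, Finset.mem_univ i⟩) (neg_add_cancel _)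
    rw [h0, eq_comm, mul_eq_zero, or_iff_right hne, neg_eq_zero] at key
    rw [key, mul_zero]
end

section
/- Let (a_n) be positive reals, strictly decreasing, and suppose there are d with 1 < d < 2 and δ > 0 with n^d a_n ≥ δ for all n, and (n^d a_n) eventually monotonically increasing. Define α_n := (1/n)∑_{m≠n} ln|1 − a_m/a_n|. Then limsup_{n→∞} α_n ≤ ζ(d), where ζ(d) := ∫₀¹ ln(1/z^d − 1)dz + ∫₁^∞ ln(1 − 1/z^d)dz. -/
open Real Set Filter Topology MeasureTheory

/-- The singular integrand on `(0, 1)` is antitone. -/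
lemma antitoneOn_log_one_div_rpow_sub_one {d : ℝ} (hd : 0 < d) :
    AntitoneOn (fun z : ℝ => log (1 / z ^ d - 1)) (Ioo 0 1) := by
  intro x hx y hy hxy
  have hy1 : y ^ d < 1 := rpow_lt_one hy.1.le hy.2 hd
  have hy0 : 0 < y ^ d := rpow_pos_of_pos hy.1 d
  have hx0 : 0 < x ^ d := rpow_pos_of_pos hx.1 d
  have h : 1 < 1 / y ^ d := by rw [lt_div_iff₀ hy0]; linarith
  have h2 : x ^ d ≤ y ^ d := rpow_le_rpow hx.1.le hxy hd.le
  have h3 : 1 / y ^ d ≤ 1 / x ^ d := one_div_le_one_div_of_le hx0 h2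
  exact log_le_log (by linarith) (by linarith)

/-- The singular integrand on `(1, ∞)` is monotone. -/
lemma monotoneOn_log_one_sub_one_div_rpow {d : ℝ} (hd : 0 < d) :
    MonotoneOn (fun z : ℝ => log (1 - 1 / z ^ d)) (Ioi 1) := by
  intro x hx y hy hxy
  have hx1 : (1 : ℝ) < x := hx
  have h1 : 1 < x ^ d := one_lt_rpow hx1 hd
  have h2 : x ^ d ≤ y ^ d := rpow_le_rpow (by linarith) hxy hd.le
  have h3 : 1 / y ^ d ≤ 1 / x ^ d := one_div_le_one_div_of_le (by linarith) h2
  have h4 : 1 / x ^ d < 1 := by rw [div_lt_one (by linarith)]; exact h1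
  exact log_le_log (by linarith) (by linarith)

lemma intervalIntegrable_log_one_div_rpow_sub_one {d : ℝ} (hd : 1 ≤ d) :
    IntervalIntegrable (fun z : ℝ => log (1 / z ^ d - 1)) volume 0 1 := by
  have hlog : IntervalIntegrable log volume (0 : ℝ) 1 := intervalIntegral.intervalIntegrable_log'
  have hrefl : IntervalIntegrable (fun z : ℝ => log (1 - z)) volume 0 1 := by
    simpa using ((intervalIntegral.intervalIntegrable_log' (a := 0) (b := 1)).comp_sub_left 1).symm
  refine ((hlog.abs.const_mul d).add hrefl.abs).mono_fun
    (Measurable.aestronglyMeasurable (by fun_prop)) ?_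
  rw [uIoc_of_le zero_le_one, ← restrict_Ioo_eq_restrict_Ioc]
  filter_upwards [ae_restrict_mem measurableSet_Ioo] with z hz
  have hz0 : 0 < z ^ d := rpow_pos_of_pos hz.1 d
  have hzz : z ^ d ≤ z := by
    simpa using rpow_le_rpow_of_exponent_ge hz.1 hz.2.le hd
  have hsplit : log (1 / z ^ d - 1) = log (1 - z ^ d) - d * log z := by
    rw [← log_rpow hz.1, ← log_div (by linarith [hz.2]) hz0.ne']
    congr 1
    field_simp
  have h1 : log (1 - z ^ d) ≤ 0 := log_nonpos (by linarith [hz.2]) (by linarith)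
  have h2 : log (1 - z) ≤ log (1 - z ^ d) := log_le_log (by linarith [hz.2]) (by linarith)
  have h3 : log z ≤ 0 := log_nonpos hz.1.le hz.2.le
  have h5 : d * log z ≤ 0 := mul_nonpos_of_nonneg_of_nonpos (by linarith) h3
  rw [hsplit, norm_eq_abs, norm_eq_abs]
  refine le_trans ?_ (le_abs_self _)
  rw [abs_of_nonpos h3, abs_of_nonpos (h2.trans h1), abs_le]
  constructor <;> linarith

lemma integrableOn_log_one_sub_one_div_rpow {d : ℝ} (hd : 1 < d) :
    IntegrableOn (fun z : ℝ => log (1 - 1 / z ^ d)) (Ioi 1) := by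
  rw [← Ioc_union_Ioi_eq_Ioi (one_le_two : (1 : ℝ) ≤ 2)]
  refine IntegrableOn.union ?_ ?_
  · rw [← intervalIntegrable_iff_integrableOn_Ioc_of_le one_le_two]
    have hlog : IntervalIntegrable log volume (1 : ℝ) 2 := intervalIntegral.intervalIntegrable_log'
    have hshift : IntervalIntegrable (fun z : ℝ => log (z - 1)) volume 1 2 := by
      have := (intervalIntegral.intervalIntegrable_log' (a := 0) (b := 1)).comp_sub_right 1
      norm_num at this
      exact this
    refine (hshift.sub hlog).mono_fun (Measurable.aestronglyMeasurable (by fun_prop)) ?_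
    rw [uIoc_of_le one_le_two]
    filter_upwards [ae_restrict_mem measurableSet_Ioc] with z hz
    have hz1 : 1 < z := hz.1
    have hzz : z ≤ z ^ d := by
      simpa using rpow_le_rpow_of_exponent_le hz1.le hd.le
    have h3 : 1 / z ^ d ≤ 1 / z := one_div_le_one_div_of_le (by linarith) hzz
    have h4 : 1 / z < 1 := by rw [div_lt_one (by linarith)]; exact hz1
    have h5 : 0 < 1 / z ^ d := by positivity
    have hsplit : log (z - 1) - log z = log (1 - 1 / z) := by
      rw [← log_div (by linarith) (by linarith)]
      congr 1
      field_simp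
    have h6 : log (1 - 1 / z) ≤ log (1 - 1 / z ^ d) := log_le_log (by linarith) (by linarith)
    have h7 : log (1 - 1 / z ^ d) ≤ 0 := log_nonpos (by linarith) (by linarith)
    rw [hsplit, norm_eq_abs, norm_eq_abs, abs_of_nonpos h7, abs_of_nonpos (h6.trans h7)]
    linarith
  · have hint : IntegrableOn (fun z : ℝ => 2 * z ^ (-d)) (Ioi 2) :=
      (integrableOn_Ioi_rpow_of_lt (by linarith) two_pos).const_mul 2
    refine Integrable.mono' hint (Measurable.aestronglyMeasurable (by fun_prop)) ?_
    filter_upwards [ae_restrict_mem measurableSet_Ioi] with z hz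
    have hz2 : 2 < z := hz
    have hzz : z ≤ z ^ d := by
      simpa using rpow_le_rpow_of_exponent_le (by linarith : (1 : ℝ) ≤ z) hd.le
    rw [rpow_neg (by linarith), ← one_div]
    have h3 : 1 / z ^ d ≤ 1 / 2 := one_div_le_one_div_of_le two_pos (by linarith)
    have h5 : 0 < 1 / z ^ d := by positivity
    set x := 1 / z ^ d
    have h7 : log (1 - x) ≤ 0 := log_nonpos (by linarith) (by linarith)
    have h8 : 1 - (1 - x)⁻¹ ≤ log (1 - x) := one_sub_inv_le_log_of_pos (by linarith)
    have h9 : (1 - x)⁻¹ ≤ 1 + 2 * x := by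
      rw [inv_le_iff_one_le_mul₀ (by linarith)]
      nlinarith
    rw [norm_eq_abs, abs_of_nonpos h7]
    linarith

/-- Right-endpoint Riemann sums of the integrand on `(0, 1)` are bounded by its integral. -/
lemma sum_log_one_div_rpow_sub_one_le {d : ℝ} (hd : 0 < d) {k n : ℕ} (hk : 1 ≤ k) (hkn : k ≤ n) :
    ∑ m ∈ Finset.Ico k n, log (1 / (((m : ℝ) + 1) / ((n : ℝ) + 1)) ^ d - 1) ≤
      ((n : ℝ) + 1) * ∫ z in (k / ((n : ℝ) + 1))..(n / ((n : ℝ) + 1)), log (1 / z ^ d - 1) := by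
  have hN : (0 : ℝ) < (n : ℝ) + 1 := by positivity
  have hk' : (1 : ℝ) ≤ k := by exact_mod_cast hk
  have hanti : AntitoneOn (fun x : ℝ => log (1 / (x / ((n : ℝ) + 1)) ^ d - 1)) (Icc k n) := by
    have key : ∀ x ∈ Icc (k : ℝ) n, x / ((n : ℝ) + 1) ∈ Ioo (0 : ℝ) 1 := fun x hx =>
      ⟨div_pos (by linarith [hx.1]) hN, by rw [div_lt_one hN]; linarith [hx.2]⟩
    intro x hx y hy hxy
    exact antitoneOn_log_one_div_rpow_sub_one hd (key x hx) (key y hy)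
      (div_le_div_of_nonneg_right hxy hN.le)
  have := hanti.sum_le_integral_Ico hkn
  rw [intervalIntegral.integral_comp_div (fun z : ℝ => log (1 / z ^ d - 1)) hN.ne',
    smul_eq_mul] at this
  simpa only [Nat.cast_add, Nat.cast_one] using this

/-- Left-endpoint Riemann sums of the integrand on `(1, ∞)` are bounded by its integral. -/
lemma sum_log_one_sub_one_div_rpow_le {d : ℝ} (hd : 0 < d) {n M : ℕ} (hM : n + 1 ≤ M) :
    ∑ m ∈ Finset.Ico (n + 1) M, log (1 - 1 / (((m : ℝ) + 1) / ((n : ℝ) + 1)) ^ d) ≤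
      ((n : ℝ) + 1) * ∫ z in (((n : ℝ) + 2) / ((n : ℝ) + 1))..(((M : ℝ) + 1) / ((n : ℝ) + 1)),
        log (1 - 1 / z ^ d) := by
  have hN : (0 : ℝ) < (n : ℝ) + 1 := by positivity
  have hmono : MonotoneOn (fun x : ℝ => log (1 - 1 / (x / ((n : ℝ) + 1)) ^ d))
      (Icc ((n + 1 + 1 : ℕ) : ℝ) ((M + 1 : ℕ) : ℝ)) := by
    have key : ∀ x ∈ Icc ((n + 1 + 1 : ℕ) : ℝ) ((M + 1 : ℕ) : ℝ),
        x / ((n : ℝ) + 1) ∈ Ioi (1 : ℝ) := fun x hx => by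
      have := hx.1
      push_cast at this
      rw [mem_Ioi, one_lt_div hN]
      linarith
    intro x hx y hy hxy
    exact monotoneOn_log_one_sub_one_div_rpow hd (key x hx) (key y hy)
      (div_le_div_of_nonneg_right hxy hN.le)
  have := hmono.sum_le_integral_Ico (by omega)
  rw [intervalIntegral.integral_comp_div (fun z : ℝ => log (1 - 1 / z ^ d)) hN.ne',
    smul_eq_mul, ← Finset.sum_Ico_add'] at this
  have h2 : ((n : ℝ) + 1 + 1) = n + 2 := by ring
  simpa only [Nat.cast_add, Nat.cast_one, h2] using this

lemma tendsto_natCast_div_add_one_zero (k : ℕ) :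
    Tendsto (fun n : ℕ => (k : ℝ) / ((n : ℝ) + 1)) atTop (𝓝 0) :=
  (tendsto_natCast_atTop_atTop.atTop_add tendsto_const_nhds).const_div_atTop _

lemma tendsto_integral_log_one_div_rpow_sub_one {d : ℝ} (hd : 1 ≤ d) (k : ℕ) :
    Tendsto (fun n : ℕ => ∫ z in (k / ((n : ℝ) + 1))..(n / ((n : ℝ) + 1)), log (1 / z ^ d - 1))
      atTop (𝓝 (∫ z in (0 : ℝ)..1, log (1 / z ^ d - 1))) := by
  have hint := intervalIntegrable_log_one_div_rpow_sub_one hd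
  have hcont := intervalIntegral.continuousOn_primitive_interval' hint left_mem_uIcc
  rw [uIcc_of_le zero_le_one] at hcont
  have hk := tendsto_natCast_div_add_one_zero k
  have hn : Tendsto (fun n : ℕ => (n : ℝ) / ((n : ℝ) + 1)) atTop (𝓝 1) :=
    tendsto_natCast_div_add_atTop 1
  have hkmem : ∀ᶠ n : ℕ in atTop, (k : ℝ) / ((n : ℝ) + 1) ∈ Icc (0 : ℝ) 1 := by
    filter_upwards [eventually_ge_atTop k] with n h
    have : (k : ℝ) ≤ n := by exact_mod_cast h
    exact ⟨by positivity, by rw [div_le_one (by positivity)]; linarith⟩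
  have hnmem : ∀ᶠ n : ℕ in atTop, (n : ℝ) / ((n : ℝ) + 1) ∈ Icc (0 : ℝ) 1 :=
    Eventually.of_forall fun n =>
      ⟨by positivity, by rw [div_le_one (by positivity)]; linarith⟩
  have h1 := (hcont 1 (by simp)).tendsto.comp (tendsto_nhdsWithin_iff.2 ⟨hn, hnmem⟩)
  have h0 := (hcont 0 (by simp)).tendsto.comp (tendsto_nhdsWithin_iff.2 ⟨hk, hkmem⟩)
  have h := h1.sub h0
  rw [intervalIntegral.integral_same, sub_zero] at h
  refine h.congr' ?_
  filter_upwards [hkmem, hnmem] with n ha hb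
  refine intervalIntegral.integral_interval_sub_left (hint.mono_set ?_) (hint.mono_set ?_)
  · exact uIcc_subset_uIcc left_mem_uIcc (by rwa [uIcc_of_le zero_le_one])
  · exact uIcc_subset_uIcc left_mem_uIcc (by rwa [uIcc_of_le zero_le_one])

lemma tendsto_integral_log_one_sub_one_div_rpow {d : ℝ} (hd : 1 < d) :
    Tendsto (fun n : ℕ => ∫ z in Ioi (((n : ℝ) + 2) / ((n : ℝ) + 1)), log (1 - 1 / z ^ d))
      atTop (𝓝 (∫ z in Ioi (1 : ℝ), log (1 - 1 / z ^ d))) := by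
  have hint := integrableOn_log_one_sub_one_div_rpow hd
  have hI : IntervalIntegrable (fun z : ℝ => log (1 - 1 / z ^ d)) volume 1 2 :=
    (intervalIntegrable_iff_integrableOn_Ioc_of_le one_le_two).2
      (hint.mono_set Ioc_subset_Ioi_self)
  have hcont := intervalIntegral.continuousOn_primitive_interval' hI left_mem_uIcc
  rw [uIcc_of_le one_le_two] at hcont
  have heq : ∀ n : ℕ, ((n : ℝ) + 2) / ((n : ℝ) + 1) = 1 + (1 : ℕ) / ((n : ℝ) + 1) := fun n => by
    field_simp
    push_cast
    ring
  have hn : Tendsto (fun n : ℕ => ((n : ℝ) + 2) / ((n : ℝ) + 1)) atTop (𝓝 1) := by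
    simpa only [heq, add_zero] using (tendsto_natCast_div_add_one_zero 1).const_add 1
  have hge : ∀ n : ℕ, 1 ≤ ((n : ℝ) + 2) / ((n : ℝ) + 1) := fun n => by
    rw [one_le_div (by positivity)]; linarith
  have hmem : ∀ᶠ n : ℕ in atTop, ((n : ℝ) + 2) / ((n : ℝ) + 1) ∈ Icc (1 : ℝ) 2 :=
    Eventually.of_forall fun n =>
      ⟨hge n, by rw [div_le_iff₀ (by positivity)]; linarith [n.cast_nonneg (α := ℝ)]⟩
  have h := ((hcont 1 (by simp)).tendsto.comp
    (tendsto_nhdsWithin_iff.2 ⟨hn, hmem⟩)).const_sub (∫ z in Ioi (1 : ℝ), log (1 - 1 / z ^ d))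
  rw [intervalIntegral.integral_same, sub_zero] at h
  refine h.congr fun n => ?_
  have := intervalIntegral.integral_Ioi_sub_Ioi hint (hge n)
  simp only [Function.comp_apply]
  linarith

/-- A crude logarithmic bound for the finitely many initial terms. -/
lemma log_abs_one_sub_div_le {a : ℕ → ℝ} (hapos : ∀ n, 0 < a n) (hanti : StrictAnti a)
    {d δ : ℝ} (hδ : 0 < δ) (hlb : ∀ n : ℕ, δ ≤ ((n : ℝ) + 1) ^ d * a n) {m n : ℕ} (hmn : m < n) :
    log |1 - a m / a n| ≤ log (a 0 / δ) + d * log ((n : ℝ) + 1) := by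
  have hN : (0 : ℝ) < (n : ℝ) + 1 := by positivity
  have h1 : 1 < a m / a n := by rw [one_lt_div (hapos n)]; exact hanti hmn
  rw [← log_rpow hN, ← log_mul (div_pos (hapos 0) hδ).ne' (by positivity), abs_of_neg (by linarith)]
  refine log_le_log (by linarith) ?_
  have h2 : a m ≤ a 0 := hanti.antitone (Nat.zero_le m)
  have h3 : a m / a n ≤ a 0 / δ * ((n : ℝ) + 1) ^ d := by
    rw [div_mul_eq_mul_div, div_le_div_iff₀ (hapos n) hδ]
    calc a m * δ ≤ a 0 * (((n : ℝ) + 1) ^ d * a n) :=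
          mul_le_mul h2 (hlb n) hδ.le (hapos 0).le
      _ = _ := by ring
  linarith

lemma div_le_one_div_rpow {d x y u v : ℝ} (hx : 0 < x) (hy : 0 < y) (hv : 0 < v)
    (h : x ^ d * u ≤ y ^ d * v) : u / v ≤ 1 / (x / y) ^ d := by
  have hx' := rpow_pos_of_pos hx d
  rw [div_rpow hx.le hy.le, one_div_div, div_le_div_iff₀ hv hx']
  linarith

lemma one_div_rpow_le_div {d x y u v : ℝ} (hx : 0 < x) (hy : 0 < y) (hv : 0 < v)
    (h : y ^ d * v ≤ x ^ d * u) : 1 / (x / y) ^ d ≤ u / v := by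
  have hx' := rpow_pos_of_pos hx d
  rw [div_rpow hx.le hy.le, one_div_div, div_le_div_iff₀ hx' hv]
  linarith

/-- Comparison of the partial sums with the two integrals. -/
lemma sum_log_abs_one_sub_div_le {a : ℕ → ℝ} (hapos : ∀ n, 0 < a n) (hanti : StrictAnti a)
    {d δ : ℝ} (hd : 0 < d) (hδ : 0 < δ) (hlb : ∀ n : ℕ, δ ≤ ((n : ℝ) + 1) ^ d * a n) {k : ℕ}
    (hk : 1 ≤ k) (hmono : ∀ m n : ℕ, k ≤ m → m ≤ n →
      ((m : ℝ) + 1) ^ d * a m ≤ ((n : ℝ) + 1) ^ d * a n)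
    {n M : ℕ} (hkn : k ≤ n) (hM : n + 1 ≤ M) :
    (1 / ((n : ℝ) + 1)) * ∑ m ∈ Finset.range M, (if m = n then 0 else log |1 - a m / a n|) ≤
      k * (log (a 0 / δ) + d * log ((n : ℝ) + 1)) / ((n : ℝ) + 1) +
        (∫ z in (k / ((n : ℝ) + 1))..(n / ((n : ℝ) + 1)), log (1 / z ^ d - 1)) +
        ∫ z in (((n : ℝ) + 2) / ((n : ℝ) + 1))..(((M : ℝ) + 1) / ((n : ℝ) + 1)),
          log (1 - 1 / z ^ d) := by
  have hN : (0 : ℝ) < (n : ℝ) + 1 := by positivity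
  set t : ℕ → ℝ := fun m => if m = n then 0 else log |1 - a m / a n| with ht
  have hsplit : ∑ m ∈ Finset.range M, t m = ∑ m ∈ Finset.range k, t m +
      ∑ m ∈ Finset.Ico k n, t m + ∑ m ∈ Finset.Ico (n + 1) M, t m := by
    rw [← Finset.sum_range_add_sum_Ico t hM, Finset.sum_range_succ,
      ← Finset.sum_range_add_sum_Ico t hkn]
    simp [ht]
  have h1 : ∑ m ∈ Finset.range k, t m ≤ k * (log (a 0 / δ) + d * log ((n : ℝ) + 1)) := by
    have := Finset.sum_le_card_nsmul (Finset.range k) t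
      (log (a 0 / δ) + d * log ((n : ℝ) + 1)) fun m hm => by
        have hmn : m < n := (Finset.mem_range.1 hm).trans_le hkn
        simp only [ht, if_neg hmn.ne]
        exact log_abs_one_sub_div_le hapos hanti hδ hlb hmn
    simpa only [Finset.card_range, nsmul_eq_mul] using this
  have h2 : ∑ m ∈ Finset.Ico k n, t m ≤
      ∑ m ∈ Finset.Ico k n, log (1 / (((m : ℝ) + 1) / ((n : ℝ) + 1)) ^ d - 1) := by
    refine Finset.sum_le_sum fun m hm => ?_
    obtain ⟨hkm, hmn⟩ := Finset.mem_Ico.1 hm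
    have hlt : 1 < a m / a n := by rw [one_lt_div (hapos n)]; exact hanti hmn
    simp only [ht, if_neg hmn.ne]
    rw [abs_of_neg (by linarith)]
    have := div_le_one_div_rpow (by positivity) hN (hapos n) (hmono m n hkm hmn.le)
    exact log_le_log (by linarith) (by linarith)
  have h3 : ∑ m ∈ Finset.Ico (n + 1) M, t m ≤
      ∑ m ∈ Finset.Ico (n + 1) M, log (1 - 1 / (((m : ℝ) + 1) / ((n : ℝ) + 1)) ^ d) := by
    refine Finset.sum_le_sum fun m hm => ?_
    have hnm : n < m := (Finset.mem_Ico.1 hm).1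
    have hlt : a m / a n < 1 := by rw [div_lt_one (hapos n)]; exact hanti hnm
    simp only [ht, if_neg hnm.ne']
    rw [abs_of_pos (by linarith)]
    have := one_div_rpow_le_div (by positivity) hN (hapos n) (hmono n m hkn hnm.le)
    exact log_le_log (by linarith) (by linarith)
  have h2' := h2.trans (sum_log_one_div_rpow_sub_one_le hd hk hkn)
  have h3' := h3.trans (sum_log_one_sub_one_div_rpow_le hd hM)
  rw [hsplit, one_div_mul_eq_div, div_le_iff₀ hN, add_mul, add_mul, div_mul_cancel₀ _ hN.ne']
  linarith

lemma tendsto_log_add_one_div_add_one (k c d : ℝ) :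
    Tendsto (fun n : ℕ => k * (c + d * log ((n : ℝ) + 1)) / ((n : ℝ) + 1)) atTop (𝓝 0) := by
  have hN : Tendsto (fun n : ℕ => (n : ℝ) + 1) atTop atTop :=
    tendsto_natCast_atTop_atTop.atTop_add tendsto_const_nhds
  have h1 : Tendsto (fun n : ℕ => log ((n : ℝ) + 1) / ((n : ℝ) + 1)) atTop (𝓝 0) :=
    isLittleO_log_id_atTop.tendsto_div_nhds_zero.comp hN
  have h2 : Tendsto (fun n : ℕ => c / ((n : ℝ) + 1)) atTop (𝓝 0) := hN.const_div_atTop c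
  have h := (h2.add (h1.const_mul d)).const_mul k
  simp only [mul_zero, add_zero] at h
  exact h.congr fun n => by ring

/-- The inner `limsup` over partial sums (in `EReal`) interprets the possibly
divergent series `∑_{m≠n} ln|1 − a_m/a_n|`; sequences are 1-indexed via `n ↦ n+1`. -/
theorem stmt_19 (a : ℕ → ℝ) (hapos : ∀ n, 0 < a n) (hanti : StrictAnti a)
    (d δ : ℝ) (hd1 : 1 < d) (hd2 : d < 2) (hδ : 0 < δ)
    (hlb : ∀ n : ℕ, δ ≤ ((n : ℝ) + 1) ^ d * a n)
    (hmono : ∃ n₀ : ℕ, ∀ m n : ℕ, n₀ ≤ m → m ≤ n →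
      ((m : ℝ) + 1) ^ d * a m ≤ ((n : ℝ) + 1) ^ d * a n) :
    Filter.limsup
      (fun n : ℕ => Filter.limsup
        (fun M : ℕ =>
          (((1 / ((n : ℝ) + 1)) *
            ∑ m ∈ Finset.range M, if m = n then 0 else Real.log |1 - a m / a n| : ℝ) : EReal))
        Filter.atTop)
      Filter.atTop
    ≤ (((∫ z in (0:ℝ)..1, Real.log (1 / z ^ d - 1))
        + ∫ z in Set.Ioi (1:ℝ), Real.log (1 - 1 / z ^ d) : ℝ) : EReal) := by
  obtain ⟨n₀, hmono⟩ := hmono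
  set k := max n₀ 1
  have hlim := ((tendsto_log_add_one_div_add_one k (log (a 0 / δ)) d).add
    (tendsto_integral_log_one_div_rpow_sub_one hd1.le k)).add
    (tendsto_integral_log_one_sub_one_div_rpow hd1)
  rw [zero_add] at hlim
  refine le_trans (limsup_le_limsup ?_) ((EReal.tendsto_coe.2 hlim).limsup_eq).le
  filter_upwards [eventually_ge_atTop k] with n hkn
  have hN : (0 : ℝ) < (n : ℝ) + 1 := by positivity
  have hsub : Ioi (((n : ℝ) + 2) / ((n : ℝ) + 1)) ⊆ Ioi 1 :=
    Ioi_subset_Ioi (by rw [one_le_div hN]; linarith)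
  have hM : Tendsto (fun M : ℕ => ((M : ℝ) + 1) / ((n : ℝ) + 1)) atTop atTop :=
    (tendsto_natCast_atTop_atTop.atTop_add tendsto_const_nhds).atTop_div_const hN
  have htail := (intervalIntegral_tendsto_integral_Ioi _
    ((integrableOn_log_one_sub_one_div_rpow hd1).mono_set hsub) hM).const_add
    (k * (log (a 0 / δ) + d * log ((n : ℝ) + 1)) / ((n : ℝ) + 1) +
      ∫ z in (k / ((n : ℝ) + 1))..(n / ((n : ℝ) + 1)), log (1 / z ^ d - 1))
  refine le_trans (limsup_le_limsup ?_) ((EReal.tendsto_coe.2 htail).limsup_eq).le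
  filter_upwards [eventually_ge_atTop (n + 1)] with M hnM
  exact EReal.coe_le_coe_iff.2 (sum_log_abs_one_sub_div_le hapos hanti (by linarith) hδ hlb
    (le_max_right _ _) (fun m n h => hmono m n ((le_max_left _ _).trans h)) hkn hnM)
end
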